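/- Quantitative one-sided converse Taylor theorem with Gevrey-2 bounds: let C ≥ 0, f : ℝ → ℝ, and a : ℝ → ℕ → ℝ be such that |a(x,j)| ≤ (j!)^2 C^j for all x ∈ [0,1) and j ∈ ℕ, and such that for every x ∈ [0,1), every k ∈ ℕ, and every p ∈ [0, 1−x], |f(x+p) − ∑_{j=0}^{k} (p^j / j!) a(x,j)| ≤ (k+1)! (Cp)^{k+1}. Then f is infinitely differentiable on the open interval (0,1), its derivatives are given by f^{(j)}(x) = a(x,j) for every x ∈ (0,1) and j ∈ ℕ, and in particular f satisfies the Gevrey-2 bounds |f^{(j)}(x)| ≤ (j!)^2 C^j on (0,1). -/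

import Mathlib

open Finset Set

/-- The coefficients of a polynomial of degree less than `n` are controlled by its supremum
on `[0,1]`. -/
theorem exists_coeff_bound (n : ℕ) :
    ∃ K : ℝ, 0 ≤ K ∧ ∀ (c : ℕ → ℝ) (M : ℝ),
      (∀ t ∈ Icc (0 : ℝ) 1, |∑ j ∈ range n, c j * t ^ j| ≤ M) →
        ∀ j < n, |c j| ≤ K * M := by
  classical
  let v : Fin n → ℝ := fun i => 1 / ((i : ℝ) + 1)
  have hv : Function.Injective v := by
    intro i j hij
    have h : (i : ℝ) + 1 = (j : ℝ) + 1 := by simpa [v] using hij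
    exact Fin.ext (by exact_mod_cast add_right_cancel h)
  let V := Matrix.vandermonde v
  have hV : IsUnit V.det := (Matrix.det_vandermonde_ne_zero_iff.mpr hv).isUnit
  refine ⟨∑ i, ∑ l, |V⁻¹ i l|, by positivity, fun c M hM j hj => ?_⟩
  have hval : ∀ l, |V.mulVec (fun i => c i) l| ≤ M := by
    intro l
    have hl : V.mulVec (fun i => c i) l = ∑ i ∈ range n, c i * v l ^ i := by
      rw [← Fin.sum_univ_eq_sum_range (fun i => c i * v l ^ i)]
      simp [V, Matrix.mulVec, dotProduct, Matrix.vandermonde_apply, mul_comm]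
    rw [hl]
    refine hM _ ⟨by positivity, ?_⟩
    exact (div_le_one (by positivity)).mpr (by linarith [Nat.cast_nonneg (α := ℝ) (l : ℕ)])
  have hM0 : 0 ≤ M := (abs_nonneg _).trans (hval ⟨j, hj⟩)
  have hc : c j = ∑ l, V⁻¹ ⟨j, hj⟩ l * V.mulVec (fun i => c i) l := by
    have h : V⁻¹.mulVec (V.mulVec (fun i => c i)) = fun i : Fin n => c i := by
      rw [Matrix.mulVec_mulVec, Matrix.nonsing_inv_mul V hV, Matrix.one_mulVec]
    exact (congrFun h ⟨j, hj⟩).symm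
  calc |c j| ≤ ∑ l, |V⁻¹ ⟨j, hj⟩ l| * M := by
        rw [hc]
        refine (abs_sum_le_sum_abs _ _).trans (sum_le_sum fun l _ => ?_)
        rw [abs_mul]
        exact mul_le_mul_of_nonneg_left (hval l) (abs_nonneg _)
    _ = (∑ l, |V⁻¹ ⟨j, hj⟩ l|) * M := (sum_mul _ _ _).symm
    _ ≤ (∑ i, ∑ l, |V⁻¹ i l|) * M := by
        refine mul_le_mul_of_nonneg_right ?_ hM0
        exact single_le_sum (f := fun i => ∑ l, |V⁻¹ i l|)
          (fun i _ => sum_nonneg fun l _ => abs_nonneg _) (mem_univ _)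

/-- Re-expansion of a Taylor polynomial about a shifted base point. -/
theorem taylor_sum_add (n : ℕ) (b : ℕ → ℝ) (s h : ℝ) :
    ∑ j ∈ range n, (s + h) ^ j / (Nat.factorial j : ℝ) * b j =
      ∑ m ∈ range n, s ^ m / (Nat.factorial m : ℝ) *
        ∑ i ∈ range (n - m), h ^ i / (Nat.factorial i : ℝ) * b (m + i) := by
  have hflip := sum_range_diag_flip n fun m i =>
    s ^ m / (Nat.factorial m : ℝ) * (h ^ i / (Nat.factorial i : ℝ) * b (m + i))
  simp only [mul_sum]
  rw [← hflip]
  refine sum_congr rfl fun j _ => ?_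
  rw [add_pow, sum_div, sum_mul]
  refine sum_congr rfl fun m hm => ?_
  have hmj : m ≤ j := Nat.lt_succ_iff.mp (Finset.mem_range.mp hm)
  rw [Nat.add_sub_cancel' hmj, Nat.cast_choose ℝ hmj]
  have := Nat.factorial_ne_zero j
  field_simp

/-- Uniform forward Taylor expansions of `f` of order `k` with coefficients `a` induce forward
Taylor expansions of each coefficient. -/
theorem exists_forward_expansion_coeff {D : ℝ} (hD : 0 ≤ D) {f : ℝ → ℝ} {a : ℝ → ℕ → ℝ} {k : ℕ}
    (hrem : ∀ x ∈ Ico (0 : ℝ) 1, ∀ p ∈ Icc (0 : ℝ) (1 - x),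
      |f (x + p) - ∑ j ∈ range (k + 1), p ^ j / (Nat.factorial j : ℝ) * a x j|
        ≤ D * p ^ (k + 1)) {m : ℕ} (hm : m ≤ k) :
    ∃ B : ℝ, 0 ≤ B ∧ ∀ x h : ℝ, 0 ≤ x → 0 < h → x + 2 * h ≤ 1 →
      |a (x + h) m - ∑ i ∈ range (k + 1 - m), h ^ i / (Nat.factorial i : ℝ) * a x (m + i)|
        ≤ B * h ^ (k + 1 - m) := by
  obtain ⟨K, hK, hcoeff⟩ := exists_coeff_bound (k + 1)
  refine ⟨Nat.factorial m * (K * (D * (1 + 2 ^ (k + 1)))), by positivity,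
    fun x h hx hh hxh => ?_⟩
  let d : ℕ → ℝ := fun m =>
    a (x + h) m - ∑ i ∈ range (k + 1 - m), h ^ i / (Nat.factorial i : ℝ) * a x (m + i)
  have key := hcoeff (fun m => h ^ m / (Nat.factorial m : ℝ) * d m)
    (D * (1 + 2 ^ (k + 1)) * h ^ (k + 1)) (by
      rintro t ⟨ht0, ht1⟩
      have hth : t * h ≤ h := mul_le_of_le_one_left hh.le ht1
      have hth0 : 0 ≤ t * h := by positivity
      have h1 := hrem x ⟨hx, by linarith⟩ (t * h + h) ⟨by positivity, by linarith⟩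
      have h2 := hrem (x + h) ⟨by linarith, by linarith⟩ (t * h) ⟨hth0, by linarith⟩
      rw [taylor_sum_add] at h1
      rw [show x + h + t * h = x + (t * h + h) by ring] at h2
      have hsum : ∑ j ∈ range (k + 1), h ^ j / (Nat.factorial j : ℝ) * d j * t ^ j =
          ∑ j ∈ range (k + 1), (t * h) ^ j / (Nat.factorial j : ℝ) * a (x + h) j -
          ∑ j ∈ range (k + 1), (t * h) ^ j / (Nat.factorial j : ℝ) *
            ∑ i ∈ range (k + 1 - j), h ^ i / (Nat.factorial i : ℝ) * a x (j + i) := by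
        rw [← sum_sub_distrib]
        refine sum_congr rfl fun j _ => ?_
        simp only [d, mul_pow]
        ring
      have b1 : D * (t * h + h) ^ (k + 1) ≤ D * (2 * h) ^ (k + 1) := by
        gcongr
        linarith
      have b2 : D * (t * h) ^ (k + 1) ≤ D * h ^ (k + 1) := by gcongr
      rw [hsum]
      rw [mul_pow] at b1
      rw [abs_le] at h1 h2 ⊢
      constructor <;> linarith [h1.1, h1.2, h2.1, h2.2]) m (Nat.lt_succ_of_le hm)
  have hfac : (0 : ℝ) < Nat.factorial m := by positivity
  change |d m| ≤ _
  rw [abs_mul, abs_of_pos (by positivity : 0 < h ^ m / (Nat.factorial m : ℝ)),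
    show h ^ (k + 1) = h ^ m * h ^ (k + 1 - m) by rw [← pow_add]; congr 1; omega] at key
  refine le_of_mul_le_mul_left (key.trans_eq ?_)
    (by positivity : 0 < h ^ m / (Nat.factorial m : ℝ))
  field_simp

/-- A function with uniform first-order forward expansions whose first-order coefficient is
forward Lipschitz is differentiable, with that coefficient as derivative. -/
theorem hasDerivAt_of_forward_expansion {g g' : ℝ → ℝ} {B L : ℝ} (hL : 0 ≤ L)
    (hg : ∀ x h : ℝ, 0 ≤ x → 0 < h → x + 2 * h ≤ 1 → |g (x + h) - (g x + h * g' x)| ≤ B * h ^ 2)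
    (hg' : ∀ x h : ℝ, 0 ≤ x → 0 < h → x + 2 * h ≤ 1 → |g' (x + h) - g' x| ≤ L * h)
    {x : ℝ} (hx : x ∈ Ioo (0 : ℝ) 1) : HasDerivAt g (g' x) x := by
  rw [hasDerivAt_iff_isLittleO]
  refine Asymptotics.IsBigO.trans_isLittleO (g := fun y => (y - x) ^ 2) ?_ ?_
  · refine Asymptotics.IsBigO.of_bound (B + L) ?_
    have h1 : ∀ᶠ y in nhds x, y < (1 + x) / 2 := eventually_lt_nhds (by linarith [hx.2])
    have h0 : ∀ᶠ y in nhds x, 0 < y := eventually_gt_nhds hx.1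
    have h2 : ∀ᶠ y in nhds x, 2 * x - 1 < y := eventually_gt_nhds (by linarith [hx.2])
    filter_upwards [h0, h1, h2] with y hy0 hy1 hy2
    rw [Real.norm_eq_abs, Real.norm_eq_abs, abs_of_nonneg (sq_nonneg (y - x)), smul_eq_mul]
    rcases lt_trichotomy x y with hxy | rfl | hxy
    · have h := hg x (y - x) hx.1.le (by linarith) (by linarith)
      rw [add_sub_cancel] at h
      rw [show g y - g x - (y - x) * g' x = g y - (g x + (y - x) * g' x) by ring]
      nlinarith [mul_nonneg hL (sq_nonneg (y - x))]
    · simp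
    · have h := hg y (x - y) hy0.le (by linarith) (by linarith)
      have h' := hg' y (x - y) hy0.le (by linarith) (by linarith)
      rw [add_sub_cancel] at h h'
      have hmul := mul_le_mul_of_nonneg_left h' (sub_nonneg.mpr hxy.le)
      rw [← abs_of_nonneg (sub_nonneg.mpr hxy.le), ← abs_mul,
        abs_of_nonneg (sub_nonneg.mpr hxy.le)] at hmul
      rw [abs_le] at h hmul ⊢
      constructor <;> nlinarith [h.1, h.2, hmul.1, hmul.2]
  · simpa [sq_abs] using Asymptotics.isLittleO_pow_sub_sub x (m := 2) (by norm_num)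

/-- If `F (j + 1)` is the derivative of `F j` on an open set for every `j`, then `F j` is the
`j`-th iterated derivative of `F 0` there. -/
theorem eqOn_iteratedDerivWithin_of_hasDerivAt {s : Set ℝ} (hs : IsOpen s) {f : ℝ → ℝ}
    {F : ℕ → ℝ → ℝ} (hf : EqOn f (F 0) s)
    (hF : ∀ j, ∀ x ∈ s, HasDerivAt (F j) (F (j + 1) x) x) (j : ℕ) :
    EqOn (iteratedDerivWithin j f s) (F j) s := by
  induction j with
  | zero => simpa using hf
  | succ j ih =>
    intro x hx
    rw [iteratedDerivWithin_succ, derivWithin_congr ih (ih hx)]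
    exact (hF j x hx).hasDerivWithinAt.derivWithin (hs.uniqueDiffWithinAt hx)

/-- Quantitative one-sided converse Taylor theorem with Gevrey-2 bounds: if at every base
point `x ∈ [0,1)` the function `f` admits forward Taylor expansions with coefficients
`a(x,j)` bounded by `(j!)^2 C^j` and remainder `(k+1)! (Cp)^{k+1}` for `p ∈ [0, 1−x]`, then
`f` is smooth on `(0,1)`, its derivatives there are `f^{(j)}(x) = a(x,j)`, and in particular
`f` satisfies the Gevrey-2 bounds `|f^{(j)}(x)| ≤ (j!)^2 C^j` on `(0,1)`. -/
theorem converse_taylor_gevrey2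
    (C : ℝ) (hC : 0 ≤ C) (f : ℝ → ℝ) (a : ℝ → ℕ → ℝ)
    (hcoef : ∀ x ∈ Ico (0 : ℝ) 1, ∀ j : ℕ,
      |a x j| ≤ (Nat.factorial j : ℝ) ^ 2 * C ^ j)
    (hrem : ∀ x ∈ Ico (0 : ℝ) 1, ∀ (k : ℕ), ∀ p ∈ Icc (0 : ℝ) (1 - x),
      |f (x + p) - ∑ j ∈ range (k + 1), p ^ j / (Nat.factorial j : ℝ) * a x j|
        ≤ (Nat.factorial (k + 1) : ℝ) * (C * p) ^ (k + 1)) :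
    ContDiffOn ℝ (⊤ : ℕ∞) f (Ioo (0 : ℝ) 1)
    ∧ (∀ x ∈ Ioo (0 : ℝ) 1, ∀ j : ℕ,
        iteratedDerivWithin j f (Ioo (0 : ℝ) 1) x = a x j)
    ∧ ∀ x ∈ Ioo (0 : ℝ) 1, ∀ j : ℕ,
        |iteratedDerivWithin j f (Ioo (0 : ℝ) 1) x|
          ≤ (Nat.factorial j : ℝ) ^ 2 * C ^ j := by
  have hexp : ∀ j r : ℕ, ∃ B : ℝ, 0 ≤ B ∧ ∀ x h : ℝ, 0 ≤ x → 0 < h → x + 2 * h ≤ 1 →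
      |a (x + h) j - ∑ i ∈ range (r + 1), h ^ i / (Nat.factorial i : ℝ) * a x (j + i)|
        ≤ B * h ^ (r + 1) := by
    intro j r
    have h := exists_forward_expansion_coeff (f := f) (a := a) (k := j + r)
      (D := Nat.factorial (j + r + 1) * C ^ (j + r + 1)) (by positivity)
      (fun x hx p hp => (hrem x hx (j + r) p hp).trans_eq (by rw [mul_pow, mul_assoc]))
      (Nat.le_add_right j r)
    rwa [show j + r + 1 - j = r + 1 by omega] at h
  have hderiv : ∀ j, ∀ x ∈ Ioo (0 : ℝ) 1, HasDerivAt (fun y => a y j) (a x (j + 1)) x := by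
    intro j x hx
    obtain ⟨B, -, hB⟩ := hexp j 1
    obtain ⟨L, hL, hL'⟩ := hexp (j + 1) 0
    refine hasDerivAt_of_forward_expansion (g := fun y => a y j) (g' := fun y => a y (j + 1))
      (B := B) hL (fun y h hy hh hyh => ?_) (fun y h hy hh hyh => ?_) hx
    · simpa [sum_range_succ] using hB y h hy hh hyh
    · simpa using hL' y h hy hh hyh
  have hf : EqOn f (fun x => a x 0) (Ioo (0 : ℝ) 1) := by
    intro x hx
    have h := hrem x ⟨hx.1.le, hx.2⟩ 0 0 ⟨le_rfl, by linarith [hx.2]⟩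
    simpa [sub_eq_zero] using h
  have hiter := eqOn_iteratedDerivWithin_of_hasDerivAt isOpen_Ioo (F := fun j x => a x j) hf hderiv
  refine ⟨contDiffOn_of_differentiableOn_deriv fun m _ => ?_, fun x hx j => hiter j hx,
    fun x hx j => ?_⟩
  · exact DifferentiableOn.congr
      (fun x hx => (hderiv m x hx).differentiableAt.differentiableWithinAt) (hiter m)
  · rw [hiter j hx]
    exact hcoef x ⟨hx.1.le, hx.2⟩ j
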